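/- There exists a constant C > 0, independent of all the data below, with the following property. Let p > 2 and δ > 0, and let f : ℝ² → ℝ be twice continuously differentiable on the closed half-strip S⁺ = [0,∞) × [0,1]. Assume N := sup_{(s,t) ∈ S⁺} ‖D²f(s,t)‖ < ∞ and B := (∫_{S⁺} ‖Df(s,t)‖^p e^{δ s} ds dt)^{1/p} < ∞. Then for every (s,t) ∈ S⁺: ‖Df(s,t)‖ ≤ C · e^{-δ (s-1)/(p+2)} · (1 + B) · (1 + N). -/

import Mathlib

open MeasureTheory Real

noncomputable section

/-- The closed half-strip `S⁺ = [0,∞) × [0,1]` in `ℝ²`. -/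
def halfStrip : Set (ℝ × ℝ) := Set.Ici (0 : ℝ) ×ˢ Set.Icc (0 : ℝ) 1

/-- The gradient of a `C²` function is Lipschitz on the half strip, with the bound on the second
derivative as Lipschitz constant. -/
theorem norm_fderiv_sub_le_of_halfStrip {f : ℝ × ℝ → ℝ} {V : Set (ℝ × ℝ)} {N : ℝ}
    (hV : IsOpen V) (hSV : halfStrip ⊆ V) (hf : ContDiffOn ℝ 2 f V)
    (hN : ∀ x ∈ halfStrip, ‖fderiv ℝ (fderiv ℝ f) x‖ ≤ N) {x y : ℝ × ℝ}
    (hx : x ∈ halfStrip) (hy : y ∈ halfStrip) :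
    ‖fderiv ℝ f y - fderiv ℝ f x‖ ≤ N * ‖y - x‖ := by
  have hconv : Convex ℝ halfStrip := (convex_Ici 0).prod (convex_Icc 0 1)
  have hdiff : DifferentiableOn ℝ (fderiv ℝ f) V :=
    (hf.fderiv_of_isOpen (m := 1) hV (by norm_num)).differentiableOn (by norm_num)
  exact hconv.norm_image_sub_le_of_norm_fderiv_le
    (fun z hz => hdiff.differentiableAt (hV.mem_nhds (hSV hz))) hN hx hy

/-- Every point of the half strip lies in a closed square of side `r ≤ 1` contained in the half
strip, having the point on its left edge. -/
theorem exists_square_subset_halfStrip {x : ℝ × ℝ} (hx : x ∈ halfStrip) {r : ℝ} (hr : r ≤ 1) :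
    ∃ c : ℝ, Set.Icc x.1 (x.1 + r) ×ˢ Set.Icc c (c + r) ⊆ halfStrip ∧
      ∀ y ∈ Set.Icc x.1 (x.1 + r) ×ˢ Set.Icc c (c + r), ‖y - x‖ ≤ r := by
  obtain ⟨h1, h2, h3⟩ := hx
  simp only [Set.mem_Ici] at h1
  refine ⟨min x.2 (1 - r), ?_, ?_⟩
  · rintro y ⟨⟨ha, hb⟩, hc, hd⟩
    have h4 : 0 ≤ min x.2 (1 - r) := le_min h2 (by linarith)
    have h5 := min_le_right x.2 (1 - r)
    exact ⟨h1.trans ha, h4.trans hc, by linarith⟩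
  · rintro y ⟨⟨ha, hb⟩, hc, hd⟩
    have h5 := min_le_left x.2 (1 - r)
    have h6 : x.2 - r ≤ min x.2 (1 - r) := le_min (by linarith) (by linarith)
    refine max_le ?_ ?_ <;> simp only [Prod.fst_sub, Prod.snd_sub, Real.norm_eq_abs, abs_le] <;>
      constructor <;> linarith

/-- If `g ≥ u` on a square of side `r` inside the half strip whose left edge has abscissa `a`, then
the weighted integral of `g ^ p` is at least `u ^ p * exp (δ * a) * r ^ 2`. -/
theorem le_setIntegral_halfStrip_of_le_on_square {g : ℝ × ℝ → ℝ} {p δ u a c r : ℝ}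
    (hp : 0 ≤ p) (hδ : 0 ≤ δ) (hu : 0 ≤ u) (hr : 0 ≤ r) (hg : ∀ y, 0 ≤ g y)
    (hint : IntegrableOn (fun y => g y ^ p * Real.exp (δ * y.1)) halfStrip volume)
    (hsub : Set.Icc a (a + r) ×ˢ Set.Icc c (c + r) ⊆ halfStrip)
    (hgu : ∀ y ∈ Set.Icc a (a + r) ×ˢ Set.Icc c (c + r), u ≤ g y) :
    u ^ p * Real.exp (δ * a) * r ^ 2 ≤
      ∫ y in halfStrip, g y ^ p * Real.exp (δ * y.1) ∂volume := by
  set Q := Set.Icc a (a + r) ×ˢ Set.Icc c (c + r)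
  have hQ : MeasurableSet Q := measurableSet_Icc.prod measurableSet_Icc
  have hvol : (volume : Measure (ℝ × ℝ)).real Q = r ^ 2 := by
    rw [Measure.volume_eq_prod, measureReal_prod_prod, Real.volume_real_Icc_of_le (by linarith),
      Real.volume_real_Icc_of_le (by linarith)]
    ring
  have hfin : (volume : Measure (ℝ × ℝ)) Q ≠ ⊤ := (isCompact_Icc.prod isCompact_Icc).measure_ne_top
  calc u ^ p * Real.exp (δ * a) * r ^ 2
      = ∫ _ in Q, u ^ p * Real.exp (δ * a) ∂volume := by
        rw [setIntegral_const, hvol, smul_eq_mul, mul_comm]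
    _ ≤ ∫ y in Q, g y ^ p * Real.exp (δ * y.1) ∂volume := by
        refine setIntegral_mono_on (integrableOn_const hfin) (hint.mono_set hsub) hQ fun y hy => ?_
        have h1 : a ≤ y.1 := hy.1.1
        have h2 := hgu y hy
        have h3 := Real.rpow_nonneg (hg y) p
        gcongr
    _ ≤ ∫ y in halfStrip, g y ^ p * Real.exp (δ * y.1) ∂volume :=
        setIntegral_mono_set hint
          (Filter.Eventually.of_forall fun y =>
            mul_nonneg (Real.rpow_nonneg (hg y) p) (Real.exp_pos _).le)
          (Filter.Eventually.of_forall hsub)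

/-- Lemma A.3 (gradient exponential decay): there is a universal constant `C > 0`
such that any `C²` function `f` on the half strip with `‖D²f‖ ≤ N` and finite
weighted norm `B = ‖Df‖_{L^{p;δ}}` satisfies
`‖Df(s,t)‖ ≤ C e^{-δ(s-1)/(p+2)} (1 + B)(1 + N)`. -/
theorem stmt4 :
    ∃ C : ℝ, 0 < C ∧
      ∀ (p δ : ℝ) (f : ℝ × ℝ → ℝ) (V : Set (ℝ × ℝ)) (N : ℝ),
        2 < p → 0 < δ → IsOpen V → halfStrip ⊆ V → ContDiffOn ℝ 2 f V →
        (∀ x ∈ halfStrip, ‖fderiv ℝ (fderiv ℝ f) x‖ ≤ N) →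
        IntegrableOn (fun x => ‖fderiv ℝ f x‖ ^ p * Real.exp (δ * x.1)) halfStrip volume →
        ∀ x ∈ halfStrip,
          ‖fderiv ℝ f x‖ ≤ C * Real.exp (-δ * (x.1 - 1) / (p + 2)) *
            (1 + (∫ y in halfStrip, ‖fderiv ℝ f y‖ ^ p * Real.exp (δ * y.1) ∂volume) ^ (1 / p)) *
            (1 + N) := by
  refine ⟨2, two_pos, fun p δ f V N hp hδ hV hSV hf hN hint x hx => ?_⟩
  set I := ∫ y in halfStrip, ‖fderiv ℝ f y‖ ^ p * Real.exp (δ * y.1) ∂volume with hI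
  have hI0 : 0 ≤ I := integral_nonneg fun y => by positivity
  have hN0 : 0 ≤ N := (norm_nonneg (fderiv ℝ (fderiv ℝ f) x)).trans (hN x hx)
  have hx0 : 0 ≤ x.1 := hx.1
  set B := I ^ (1 / p) with hB
  have hB0 : 0 ≤ B := Real.rpow_nonneg hI0 _
  have hBp : B ^ p = I := by
    rw [hB, ← Real.rpow_mul hI0, one_div_mul_cancel (by linarith), Real.rpow_one]
  set r := Real.exp (-δ * x.1 / (p + 2)) with hr
  have hr0 : 0 < r := Real.exp_pos _
  have hr1 : r ≤ 1 := Real.exp_le_one_iff.2 (div_nonpos_of_nonpos_of_nonneg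
    (by nlinarith) (by linarith))
  have hrp : r ^ p * Real.exp (δ * x.1) * r ^ 2 = 1 := by
    rw [hr, ← Real.exp_mul, ← Real.exp_nat_mul, ← Real.exp_add, ← Real.exp_add, Real.exp_eq_one_iff]
    push_cast
    field_simp
    ring
  have hrE : r ≤ Real.exp (-δ * (x.1 - 1) / (p + 2)) :=
    Real.exp_le_exp.2 (div_le_div_of_nonneg_right (by nlinarith) (by linarith))
  suffices h : ‖fderiv ℝ f x‖ ≤ 2 * r * (1 + B) * (1 + N) from h.trans (by gcongr)
  by_contra! hlt
  obtain ⟨c, hsub, hdist⟩ := exists_square_subset_halfStrip hx hr1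
  have hge : ∀ y ∈ Set.Icc x.1 (x.1 + r) ×ˢ Set.Icc c (c + r),
      r * (1 + B) ≤ ‖fderiv ℝ f y‖ := by
    intro y hy
    have h1 := norm_fderiv_sub_le_of_halfStrip hV hSV hf hN hx (hsub hy)
    have h2 : N * ‖y - x‖ ≤ N * r := mul_le_mul_of_nonneg_left (hdist y hy) hN0
    have h3 := norm_le_norm_add_norm_sub (fderiv ℝ f y) (fderiv ℝ f x)
    have h4 : 0 ≤ r * B := mul_nonneg hr0.le hB0
    have h5 : 0 ≤ r * N := mul_nonneg hr0.le hN0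
    have h6 : 0 ≤ r * B * N := mul_nonneg h4 hN0
    linarith
  have hle := le_setIntegral_halfStrip_of_le_on_square (by linarith) hδ.le (by positivity) hr0.le
    (fun y => norm_nonneg (fderiv ℝ f y)) hint hsub hge
  rw [Real.mul_rpow hr0.le (by positivity), ← hI] at hle
  have hlt' : I < (1 + B) ^ p := hBp ▸ Real.rpow_lt_rpow hB0 (by linarith) (by linarith)
  have hrB : r ^ p * (1 + B) ^ p * Real.exp (δ * x.1) * r ^ 2 = (1 + B) ^ p := by
    linear_combination (1 + B) ^ p * hrp
  linarith
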